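/- Every K_5-minor-free graph has chromatic number at most 5. -/

import Mathlib

/-- `H` is a minor of `G`: there is a family of nonempty, pairwise disjoint,
connected branch sets in `G`, one for each vertex of `H`, such that adjacent
vertices of `H` have adjacent branch sets. -/
def SimpleGraph.IsMinorOf {W V : Type*} (H : SimpleGraph W) (G : SimpleGraph V) : Prop :=
  ∃ B : W → Set V,
    (∀ w, (B w).Nonempty) ∧
    (∀ w, (G.induce (B w)).Connected) ∧
    (Pairwise fun w₁ w₂ => Disjoint (B w₁) (B w₂)) ∧
    ∀ ⦃w₁ w₂⦄, H.Adj w₁ w₂ → ∃ v₁ ∈ B w₁, ∃ v₂ ∈ B w₂, G.Adj v₁ v₂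

/-- `G` has no `K_t`-minor (`K_t` is the complete graph on `t` vertices). -/
def SimpleGraph.KMinorFree {V : Type*} (G : SimpleGraph V) (t : ℕ) : Prop :=
  ¬ (completeGraph (Fin t)).IsMinorOf G

namespace SimpleGraph

universe u

variable {U V W : Type*}

lemma induce_singleton_connected (G : SimpleGraph V) (v : V) :
    (G.induce ({v} : Set V)).Connected :=
  .of_subsingleton

lemma induce_iUnion_connected {G : SimpleGraph V} {H : SimpleGraph W} {B : W → Set V}
    (hne : ∀ w, (B w).Nonempty) (hc : ∀ w, (G.induce (B w)).Connected)
    (hadj : ∀ ⦃w₁ w₂⦄, H.Adj w₁ w₂ → ∃ v₁ ∈ B w₁, ∃ v₂ ∈ B w₂, G.Adj v₁ v₂)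
    {C : Set W} (hC : (H.induce C).Connected) :
    (G.induce (⋃ w ∈ C, B w)).Connected := by
  have hsub : ∀ w ∈ C, B w ⊆ ⋃ w ∈ C, B w := fun w hw => Set.subset_biUnion_of_mem hw
  have hwithin : ∀ w (hw : w ∈ C) x y (hx : x ∈ B w) (hy : y ∈ B w),
      (G.induce (⋃ w ∈ C, B w)).Reachable ⟨x, hsub w hw hx⟩ ⟨y, hsub w hw hy⟩ :=
    fun w hw x y hx hy =>
      ((hc w).preconnected ⟨x, hx⟩ ⟨y, hy⟩).map (induceHomOfLE G (hsub w hw)).toHom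
  have hreach : ∀ w₁ w₂ : C, (H.induce C).Reachable w₁ w₂ →
      ∀ x y (hx : x ∈ B w₁) (hy : y ∈ B w₂),
      (G.induce (⋃ w ∈ C, B w)).Reachable ⟨x, hsub w₁ w₁.2 hx⟩ ⟨y, hsub w₂ w₂.2 hy⟩ := by
    rintro w₁ w₂ ⟨p⟩
    induction p with
    | nil => exact fun x y hx hy => hwithin _ (Subtype.prop _) x y hx hy
    | cons h p ih =>
      intro x y hx hy
      obtain ⟨a, ha, b, hb, hab⟩ := hadj h
      refine (hwithin _ (Subtype.prop _) x a hx ha).trans (Reachable.trans ?_ (ih b y hb hy))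
      exact Adj.reachable (G := G.induce _) hab
  obtain ⟨w, hw⟩ := hC.nonempty
  obtain ⟨x, hx⟩ := hne w
  have : Nonempty ↥(⋃ w ∈ C, B w) := ⟨⟨x, hsub w hw hx⟩⟩
  refine ⟨?_⟩
  rintro ⟨x, hx⟩ ⟨y, hy⟩
  obtain ⟨w₁, h₁, hx'⟩ := Set.mem_iUnion₂.1 hx
  obtain ⟨w₂, h₂, hy'⟩ := Set.mem_iUnion₂.1 hy
  exact hreach ⟨w₁, h₁⟩ ⟨w₂, h₂⟩ (hC.preconnected _ _) x y hx' hy'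

lemma IsMinorOf.trans {F : SimpleGraph U} {H : SimpleGraph W} {G : SimpleGraph V}
    (hFH : F.IsMinorOf H) (hHG : H.IsMinorOf G) : F.IsMinorOf G := by
  obtain ⟨C, hCne, hCc, hCd, hCa⟩ := hFH
  obtain ⟨B, hBne, hBc, hBd, hBa⟩ := hHG
  refine ⟨fun u => ⋃ w ∈ C u, B w, fun u => ?_,
    fun u => induce_iUnion_connected hBne hBc hBa (hCc u), fun u₁ u₂ hu => ?_,
    fun u₁ u₂ hu => ?_⟩
  · exact Set.nonempty_biUnion.2 ((hCne u).imp fun w hw => ⟨hw, hBne w⟩)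
  · simp only [Set.disjoint_iUnion_left, Set.disjoint_iUnion_right]
    exact fun w₁ h₁ w₂ h₂ => hBd ((hCd hu).ne_of_mem ‹_› ‹_›)
  · obtain ⟨w₁, h₁, w₂, h₂, hw⟩ := hCa hu
    obtain ⟨v₁, hv₁, v₂, hv₂, hv⟩ := hBa hw
    exact ⟨v₁, Set.mem_biUnion h₁ hv₁, v₂, Set.mem_biUnion h₂ hv₂, hv⟩

lemma isMinorOf_of_injective_hom {H : SimpleGraph W} {G : SimpleGraph V} (f : H →g G)
    (hf : Function.Injective f) : H.IsMinorOf G :=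
  ⟨fun w => {f w}, fun _ => Set.singleton_nonempty _, fun _ => induce_singleton_connected G _,
    fun _ _ hw => Set.disjoint_singleton.2 (hf.ne hw),
    fun _ _ hw => ⟨_, rfl, _, rfl, f.map_adj hw⟩⟩

lemma isMinorOf_map {G : SimpleGraph V} (f : V → W)
    (hf : ∀ w, (G.induce (f ⁻¹' {w})).Connected) : (G.map f).IsMinorOf G := by
  refine ⟨fun w => f ⁻¹' {w}, fun w => ?_, hf, fun w₁ w₂ hw => ?_, ?_⟩
  · obtain ⟨x, hx⟩ := (hf w).nonempty
    exact ⟨x, hx⟩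
  · exact (Set.disjoint_singleton.2 hw).preimage f
  · rintro _ _ ⟨-, x, y, hxy, rfl, rfl⟩
    exact ⟨x, rfl, y, rfl, hxy⟩

lemma KMinorFree.of_isMinorOf {H : SimpleGraph W} {G : SimpleGraph V} {t : ℕ}
    (hG : G.KMinorFree t) (h : H.IsMinorOf G) : H.KMinorFree t :=
  fun hH => hG (hH.trans h)

lemma KMinorFree.induce {G : SimpleGraph V} {t : ℕ} (hG : G.KMinorFree t) (s : Set V) :
    (G.induce s).KMinorFree t :=
  hG.of_isMinorOf (isMinorOf_of_injective_hom (Embedding.induce s).toHom Subtype.val_injective)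

lemma KMinorFree.mono {G G' : SimpleGraph V} {t : ℕ} (hG : G.KMinorFree t) (h : G' ≤ G) :
    G'.KMinorFree t :=
  hG.of_isMinorOf (isMinorOf_of_injective_hom (Hom.ofLE h) Function.injective_id)

/-- A clique `{v, a, b, e}` all of whose vertices are adjacent to a vertex or edge `{c, d}`
yields a `K₅`-minor. -/
lemma not_kMinorFree_five_of_adj {G : SimpleGraph V} {v a b e c d : V}
    (hva : G.Adj v a) (hvb : G.Adj v b) (hve : G.Adj v e) (hab : G.Adj a b) (hae : G.Adj a e)
    (hbe : G.Adj b e) (hcd : c = d ∨ G.Adj c d)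
    (hv : G.Adj v c) (ha : G.Adj a c) (hb : G.Adj b c ∨ G.Adj b d) (he : G.Adj e c ∨ G.Adj e d)
    (hdv : d ≠ v) (hda : d ≠ a) (hcb : c ≠ b) (hdb : d ≠ b) (hce : c ≠ e) (hde : d ≠ e) :
    ¬ G.KMinorFree 5 := by
  have hconn : (G.induce ({c, d} : Set V)).Connected := by
    rcases hcd with rfl | hcd
    · rw [Set.pair_eq_singleton]
      exact induce_singleton_connected G c
    · exact induce_pair_connected_of_adj hcd
  refine not_not.2 ⟨![{v}, {a}, {b}, {e}, {c, d}], ?_, ?_, ?_, ?_⟩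
  · intro i
    fin_cases i <;> simp
  · intro i
    fin_cases i
    · exact induce_singleton_connected G v
    · exact induce_singleton_connected G a
    · exact induce_singleton_connected G b
    · exact induce_singleton_connected G e
    · exact hconn
  · have h₁ := hva.ne
    have h₂ := hvb.ne
    have h₃ := hve.ne
    have h₄ := hab.ne
    have h₅ := hae.ne
    have h₆ := hbe.ne
    have h₇ := hv.ne
    have h₈ := ha.ne
    intro i j hij
    fin_cases i <;> fin_cases j <;> first | exact absurd rfl hij | (simp; grind)
  · intro i j hij
    replace hij : i ≠ j := hij
    fin_cases i <;> fin_cases j <;>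
      first | exact absurd rfl hij | (simp; grind [SimpleGraph.adj_comm])

/-- The map identifying `v` with `u`, as a map to the complement of `v`. -/
noncomputable def contractTo (u v : V) (h : u ≠ v) (x : V) : ({v}ᶜ : Set V) := by
  classical
  exact if hx : x = v then ⟨u, h⟩ else ⟨x, hx⟩

lemma coe_contractTo_self {u v : V} (h : u ≠ v) : (contractTo u v h v : V) = u := by
  simp [contractTo]

lemma coe_contractTo_of_ne {u v x : V} (h : u ≠ v) (hx : x ≠ v) :
    (contractTo u v h x : V) = x := by
  simp [contractTo, hx]

lemma isMinorOf_map_contractTo {G : SimpleGraph V} {u v : V} (h : G.Adj u v) :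
    (G.map (contractTo u v h.ne)).IsMinorOf G := by
  refine isMinorOf_map _ fun w => ?_
  by_cases hw : (w : V) = u
  · have : contractTo u v h.ne ⁻¹' {w} = {u, v} := by
      ext x
      have := coe_contractTo_self h.ne
      have := @coe_contractTo_of_ne V u v x h.ne
      simp only [Set.mem_preimage, Set.mem_singleton_iff, Set.mem_insert_iff, Subtype.ext_iff]
      grind
    rw [this]
    exact induce_pair_connected_of_adj h
  · have : contractTo u v h.ne ⁻¹' {w} = {(w : V)} := by
      ext x
      have := coe_contractTo_self h.ne
      have := @coe_contractTo_of_ne V u v x h.ne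
      have : (w : V) ≠ v := w.2
      simp only [Set.mem_preimage, Set.mem_singleton_iff, Subtype.ext_iff]
      grind
    rw [this]
    exact induce_singleton_connected G _

/-- Contracting an edge loses that edge and one edge per common neighbour of its ends. -/
lemma ncard_edgeSet_le_map_contractTo [Finite V] {G : SimpleGraph V} {u v : V} (h : G.Adj u v) :
    G.edgeSet.ncard ≤
      (G.map (contractTo u v h.ne)).edgeSet.ncard + (G.commonNeighbors u v).ncard + 1 := by
  set f := contractTo u v h.ne
  set T : Set (Sym2 V) := insert s(u, v) ((fun w => s(v, w)) '' G.commonNeighbors u v)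
  have hself : (f v : V) = u := coe_contractTo_self h.ne
  have hne : ∀ x, x = v ∨ (f x : V) = x := fun x =>
    or_iff_not_imp_left.2 fun hx => coe_contractTo_of_ne h.ne hx
  have hmaps : ∀ e ∈ G.edgeSet \ T, Sym2.map f e ∈ (G.map f).edgeSet := by
    intro e
    induction e with | _ a b
    rintro ⟨hab, hT⟩
    refine map_adj_apply' (f := f) (u := a) (v := b) hab fun hfab => hT (Or.inl ?_)
    have hab' : a ≠ b := G.ne_of_adj hab
    have := congrArg Subtype.val hfab
    simp only [Sym2.eq_iff]
    have := hne a
    have := hne b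
    clear_value f
    grind
  have hinj : Set.InjOn (Sym2.map f) (G.edgeSet \ T) := by
    intro e he e' he' hee
    induction e with | _ a b
    induction e' with | _ c d
    simp only [T, Set.mem_sdiff, mem_edgeSet, Set.mem_insert_iff, Set.mem_image,
      mem_commonNeighbors, not_or, not_exists, not_and, Sym2.eq_iff] at he he'
    simp only [Sym2.map_mk, Sym2.eq_iff, Subtype.ext_iff] at hee ⊢
    have := @G.adj_comm
    have := @G.ne_of_adj
    have := hne a
    have := hne b
    have := hne c
    have := hne d
    clear_value f
    clear hne hmaps
    grind
  have h₁ : (G.edgeSet \ T).ncard ≤ (G.map f).edgeSet.ncard :=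
    Set.ncard_le_ncard_of_injOn _ hmaps hinj
  have h₂ : T.ncard ≤ (G.commonNeighbors u v).ncard + 1 :=
    (Set.ncard_insert_le _ _).trans (Nat.add_le_add_right (Set.ncard_image_le) 1)
  have h₃ := Set.ncard_le_ncard_sdiff_add_ncard G.edgeSet T
  omega

lemma ncard_edgeSet_le_induce_compl_singleton [Fintype V] (G : SimpleGraph V)
    [DecidableRel G.Adj] (v : V) :
    G.edgeSet.ncard ≤ (G.induce {v}ᶜ).edgeSet.ncard + G.degree v := by
  classical
  have h₁ := G.card_edgeFinset_induce_compl_singleton v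
  have h₂ := G.card_edgeFinset_deleteIncidenceSet v
  rw [edgeFinset, ← Set.ncard_eq_toFinset_card'] at h₁
  have h₃ : G.edgeFinset.card = G.edgeSet.ncard := by
    rw [edgeFinset, ← Set.ncard_eq_toFinset_card']
  omega

lemma exists_le_ncard_edgeSet_eq [Finite V] (G : SimpleGraph V) {k : ℕ}
    (hk : k ≤ G.edgeSet.ncard) : ∃ G' ≤ G, G'.edgeSet.ncard = k := by
  obtain ⟨s, hs, rfl⟩ := Set.exists_subset_card_eq hk
  refine ⟨fromEdgeSet s, ?_, ?_⟩
  · simpa using Set.sdiff_subset.trans hs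
  · rw [edgeSet_fromEdgeSet, sdiff_eq_left.2]
    exact Set.disjoint_left.2 fun e he hd => G.not_isDiag_of_mem_edgeSet (hs he) hd

/-- If each of the edges at a vertex of degree four or five lies in at least three triangles,
then there is a `K₅`-minor. -/
lemma not_kMinorFree_five_of_three_le_commonNeighbors [Fintype V] [DecidableEq V]
    {G : SimpleGraph V} [DecidableRel G.Adj] {v : V} (h₄ : 4 ≤ G.degree v) (h₅ : G.degree v ≤ 5)
    (h : ∀ u ∈ G.neighborFinset v, 3 ≤ (G.neighborFinset v ∩ G.neighborFinset u).card) :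
    ¬ G.KMinorFree 5 := by
  set N := G.neighborFinset v with hN
  have hNv : ∀ x ∈ N, G.Adj v x := fun x hx => (G.mem_neighborFinset v x).1 hx
  have hcardN : N.card = G.degree v := rfl
  have hcard : ∀ S ⊆ N, ∀ u ∈ N, (∀ x ∈ S, ¬ G.Adj u x) → S.card + 3 ≤ N.card := by
    intro S hS u hu hx
    have hdisj : Disjoint S (N ∩ G.neighborFinset u) := by
      rw [Finset.disjoint_left]
      intro x hxS hxu
      exact hx x hxS ((G.mem_neighborFinset u x).1 (Finset.mem_inter.1 hxu).2)
    have := Finset.card_le_card (Finset.union_subset hS Finset.inter_subset_left :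
      S ∪ (N ∩ G.neighborFinset u) ⊆ N)
    rw [Finset.card_union_of_disjoint hdisj] at this
    have := h u hu
    omega
  rcases Nat.lt_or_ge (G.degree v) 5 with hlt | hge
  · have hadj : ∀ x ∈ N, ∀ y ∈ N, x ≠ y → G.Adj x y := by
      intro x hx y hy hxy
      by_contra hnot
      have := hcard {x, y} (by grind) x hx (by simp [hnot])
      rw [Finset.card_pair hxy] at this
      omega
    obtain ⟨a, ha⟩ : N.Nonempty := Finset.card_pos.1 (by omega)
    obtain ⟨b, c, d, hbc, hbd, hcd, hE⟩ := Finset.card_eq_three.1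
      (show (N.erase a).card = 3 by rw [Finset.card_erase_of_mem ha]; omega)
    have hb : b ∈ N.erase a := by simp [hE]
    have hc : c ∈ N.erase a := by simp [hE]
    have hd : d ∈ N.erase a := by simp [hE]
    rw [Finset.mem_erase] at hb hc hd
    have hd' := hNv d hd.2
    exact not_kMinorFree_five_of_adj (hNv a ha) (hNv b hb.2) (hNv c hc.2)
      (hadj a ha b hb.2 hb.1.symm) (hadj a ha c hc.2 hc.1.symm) (hadj b hb.2 c hc.2 hbc)
      (Or.inl (rfl : d = d)) hd' (hadj a ha d hd.2 hd.1.symm) (Or.inl (hadj b hb.2 d hd.2 hbd))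
      (Or.inl (hadj c hc.2 d hd.2 hcd)) hd'.ne' hd.1 hbd.symm hbd.symm hcd.symm hcd.symm
  · have hadj : ∀ x ∈ N, ∀ y ∈ N, ∀ z ∈ N, x ≠ y → x ≠ z → y ≠ z → G.Adj x y ∨ G.Adj x z := by
      intro x hx y hy z hz hxy hxz hyz
      by_contra! hnot
      have := hcard {x, y, z} (by grind) x hx (by simp [hnot])
      rw [Finset.card_eq_three.2 ⟨x, y, z, hxy, hxz, hyz, rfl⟩] at this
      omega
    obtain ⟨a, ha, c, hc, hac, hall⟩ : ∃ a ∈ N, ∃ c ∈ N, a ≠ c ∧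
        ∀ x ∈ N, x ≠ a → x ≠ c → G.Adj a x ∧ G.Adj c x := by
      by_cases hex : ∃ a ∈ N, ∃ c ∈ N, a ≠ c ∧ ¬ G.Adj a c
      · obtain ⟨a, ha, c, hc, hac, hn⟩ := hex
        refine ⟨a, ha, c, hc, hac, fun x hx hxa hxc => ⟨?_, ?_⟩⟩
        · exact (hadj a ha c hc x hx hac hxa.symm hxc.symm).resolve_left hn
        · exact (hadj c hc a ha x hx hac.symm hxc.symm hxa.symm).resolve_left
            fun hca => hn hca.symm
      · push Not at hex
        obtain ⟨a, ha, c, hc, hac⟩ := Finset.one_lt_card.1 (show 1 < N.card by omega)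
        exact ⟨a, ha, c, hc, hac, fun x hx hxa hxc =>
          ⟨hex a ha x hx hxa.symm, hex c hc x hx hxc.symm⟩⟩
    have key : ∀ b ∈ N, ∀ d ∈ N, ∀ e ∈ N, b ≠ d → b ≠ e → d ≠ e → b ≠ a → d ≠ a → e ≠ a →
        b ≠ c → d ≠ c → e ≠ c → G.Adj b e → ¬ G.KMinorFree 5 := by
      intro b hb d hd e he hbd hbe hde hba hda hea hbc hdc hec hadj_be
      exact not_kMinorFree_five_of_adj (hNv a ha) (hNv b hb) (hNv e he) (hall b hb hba hbc).1
        (hall e he hea hec).1 hadj_be (Or.inr (hall d hd hda hdc).2.symm) (hNv d hd)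
        (hall d hd hda hdc).1 (Or.inr (hall b hb hba hbc).2.symm)
        (Or.inr (hall e he hea hec).2.symm) (hNv c hc).ne' hac.symm hbd.symm hbc.symm hde
        hec.symm
    obtain ⟨b, d, e, hbd, hbe, hde, hE⟩ := Finset.card_eq_three.1
      (show ((N.erase a).erase c).card = 3 by
        rw [Finset.card_erase_of_mem (by simp [hc, hac.symm]), Finset.card_erase_of_mem ha]; omega)
    have hb : b ∈ (N.erase a).erase c := by simp [hE]
    have hd : d ∈ (N.erase a).erase c := by simp [hE]
    have he : e ∈ (N.erase a).erase c := by simp [hE]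
    simp only [Finset.mem_erase] at hb hd he
    rcases hadj b hb.2.2 d hd.2.2 e he.2.2 hbd hbe hde with hadj' | hadj'
    · exact key b hb.2.2 e he.2.2 d hd.2.2 hbe hbd hde.symm hb.2.1 he.2.1 hd.2.1 hb.1 he.1 hd.1
        hadj'
    · exact key b hb.2.2 d hd.2.2 e he.2.2 hbd hbe hde hb.2.1 hd.2.1 he.2.1 hb.1 hd.1 he.1 hadj'

/-- **Mader's theorem** for `K₅`: a graph with `n ≥ 3` vertices and at least `3 n - 5` edges has
a `K₅`-minor. -/
theorem KMinorFree.ncard_edgeSet_add_five_lt {n : ℕ} (hn : 3 ≤ n) :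
    ∀ {V : Type u} [Fintype V] {G : SimpleGraph V}, Fintype.card V = n → G.KMinorFree 5 →
      G.edgeSet.ncard + 5 < 3 * n := by
  induction n, hn using Nat.le_induction with
  | base =>
    intro V _ G hV _
    classical
    have := G.card_edgeFinset_le_card_choose_two
    rw [hV, edgeFinset, ← Set.ncard_eq_toFinset_card'] at this
    norm_num [Nat.choose] at this
    omega
  | succ n hn ih =>
    intro V _ G hV hG
    classical
    by_contra! hlt
    obtain ⟨G', hle, hG'⟩ := G.exists_le_ncard_edgeSet_eq (k := 3 * (n + 1) - 5) (by omega)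
    replace hG := hG.mono hle
    have hcompl : ∀ v : V, Fintype.card ({v}ᶜ : Set V) = n := by
      intro v
      rw [Fintype.card_compl_set, hV]
      simp
    have hdeg : ∀ v, 3 < G'.degree v := by
      intro v
      have h₁ := ih (hcompl v) (hG.induce {v}ᶜ)
      have h₂ := G'.ncard_edgeSet_le_induce_compl_singleton v
      omega
    obtain ⟨v, hv⟩ : ∃ v, G'.degree v ≤ 5 := by
      by_contra! hall
      have h₁ := Finset.sum_le_sum fun v (_ : v ∈ Finset.univ) => Nat.succ_le_of_lt (hall v)
      have h₂ := G'.sum_degrees_eq_twice_card_edges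
      rw [edgeFinset, ← Set.ncard_eq_toFinset_card'] at h₂
      simp only [Finset.sum_const, Finset.card_univ, hV, smul_eq_mul] at h₁
      omega
    refine not_kMinorFree_five_of_three_le_commonNeighbors (hdeg v) hv (fun u hu => ?_) hG
    have hvu := (G'.mem_neighborFinset v u).1 hu
    have h₁ := ih (hcompl u) (hG.of_isMinorOf (isMinorOf_map_contractTo hvu))
    have h₂ := ncard_edgeSet_le_map_contractTo hvu
    have h₃ : (G'.commonNeighbors v u).ncard =
        (G'.neighborFinset v ∩ G'.neighborFinset u).card := by
      rw [← Set.ncard_coe_finset]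
      simp [commonNeighbors]
    omega

lemma KMinorFree.exists_degree_le_five [Fintype V] [Nonempty V] {G : SimpleGraph V}
    [DecidableRel G.Adj] (hG : G.KMinorFree 5) : ∃ v, G.degree v ≤ 5 := by
  classical
  by_contra! hall
  obtain ⟨v⟩ := ‹Nonempty V›
  have h₀ := hall v
  have h₁ := Finset.sum_le_sum fun v (_ : v ∈ Finset.univ) => Nat.succ_le_of_lt (hall v)
  have h₂ := G.sum_degrees_eq_twice_card_edges
  have h₃ := G.degree_lt_card_verts v
  have h₄ := KMinorFree.ncard_edgeSet_add_five_lt (by omega) rfl hG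
  rw [edgeFinset, ← Set.ncard_eq_toFinset_card'] at h₂
  simp only [Finset.sum_const, Finset.card_univ, smul_eq_mul] at h₁
  omega

/-- A colouring of `G` off `v` that misses a colour on the neighbours of `v` can be extended. -/
lemma colorable_of_card_image_neighborFinset_lt [Fintype V] {G : SimpleGraph V}
    [DecidableRel G.Adj] {k : ℕ} (v : V) (c : V → Fin k)
    (hc : ∀ x y, x ≠ v → y ≠ v → G.Adj x y → c x ≠ c y)
    (hv : ((G.neighborFinset v).image c).card < k) : G.Colorable k := by
  classical
  obtain ⟨i, hi⟩ : ∃ i, i ∉ (G.neighborFinset v).image c := by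
    by_contra! hall
    rw [Finset.eq_univ_iff_forall.2 hall] at hv
    simp at hv
  have hi' : ∀ x, G.Adj v x → c x ≠ i := fun x hx hxi =>
    hi (Finset.mem_image.2 ⟨x, (G.mem_neighborFinset v x).2 hx, hxi⟩)
  refine ⟨Coloring.mk (Function.update c v i) fun {x y} hxy => ?_⟩
  have := hxy.ne
  have := hxy.symm
  grind

/-- Contracting `v` together with two non-adjacent neighbours. -/
lemma exists_isMinorOf_hom_identify {G : SimpleGraph V} {v x y : V} (hx : G.Adj v x)
    (hy : G.Adj v y) (hxy : ¬ G.Adj x y) (hne : x ≠ y) :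
    ∃ (s : Set V) (H : SimpleGraph s) (f : V → s), v ∉ s ∧ H.IsMinorOf G ∧ f x = f y ∧
      ∀ a b, a ≠ v → b ≠ v → G.Adj a b → H.Adj (f a) (f b) := by
  classical
  have hvx := hx.ne
  have hvy := hy.ne
  set s : Set V := {a | a ≠ v ∧ a ≠ y} with hs
  obtain ⟨f, hf⟩ : ∃ f : V → s, ∀ a, (f a : V) = if a = v ∨ a = y then x else a :=
    ⟨fun a => ⟨if a = v ∨ a = y then x else a, by simp only [hs, Set.mem_ofPred_eq]; grind⟩,
      fun a => rfl⟩
  refine ⟨s, G.map f, f, fun h => h.1 rfl, isMinorOf_map f fun w => ?_, ?_, ?_⟩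
  · have hw : (w : V) ≠ v ∧ (w : V) ≠ y := w.2
    by_cases hwx : (w : V) = x
    · have hpre : f ⁻¹' {w} = {v, x} ∪ {v, y} := by
        ext a
        simp only [Set.mem_preimage, Set.mem_singleton_iff, Set.mem_union, Set.mem_insert_iff,
          Subtype.ext_iff, hf]
        grind
      rw [hpre]
      exact induce_union_connected (induce_pair_connected_of_adj hx).preconnected
        (induce_pair_connected_of_adj hy).preconnected ⟨v, by simp⟩
    · have hpre : f ⁻¹' {w} = {(w : V)} := by
        ext a
        simp only [Set.mem_preimage, Set.mem_singleton_iff, Subtype.ext_iff, hf]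
        grind
      rw [hpre]
      exact induce_singleton_connected G _
  · rw [Subtype.ext_iff, hf, hf]
    simp
  · intro a b ha hb hab
    refine map_adj_apply' hab fun h => ?_
    rw [Subtype.ext_iff, hf, hf] at h
    have := hab.ne
    have := hab.symm
    grind

theorem KMinorFree.colorable_five {n : ℕ} :
    ∀ {V : Type u} [Fintype V] {G : SimpleGraph V}, Fintype.card V = n → G.KMinorFree 5 →
      G.Colorable 5 := by
  induction n using Nat.strong_induction_on with | _ n ih
  intro V _ G hV hG
  classical
  rcases isEmpty_or_nonempty V with hempty | hnonempty
  · exact .of_isEmpty 5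
  obtain ⟨v, hv⟩ := hG.exists_degree_le_five
  by_cases hex : ∃ x ∈ G.neighborFinset v, ∃ y ∈ G.neighborFinset v, x ≠ y ∧ ¬ G.Adj x y
  · obtain ⟨x, hx, y, hy, hne, hxy⟩ := hex
    obtain ⟨s, H, f, hvs, hH, hfxy, hf⟩ := exists_isMinorOf_hom_identify
      ((G.mem_neighborFinset v x).1 hx) ((G.mem_neighborFinset v y).1 hy) hxy hne
    have hs : Fintype.card s < n := hV ▸ Fintype.card_subtype_lt hvs
    obtain ⟨c⟩ := ih _ hs rfl (hG.of_isMinorOf hH)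
    refine colorable_of_card_image_neighborFinset_lt v (fun a => c (f a))
      (fun a b ha hb hab => c.valid (hf a b ha hb hab)) ?_
    have himage : (G.neighborFinset v).image (fun a => c (f a)) ⊆
        ((G.neighborFinset v).erase y).image (fun a => c (f a)) := by
      intro i hi
      obtain ⟨a, ha, rfl⟩ := Finset.mem_image.1 hi
      by_cases hay : a = y
      · exact Finset.mem_image.2 ⟨x, Finset.mem_erase.2 ⟨hne, hx⟩, by rw [hay, hfxy]⟩
      · exact Finset.mem_image_of_mem _ (Finset.mem_erase.2 ⟨hay, ha⟩)
    calc _ ≤ _ := Finset.card_le_card himage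
      _ ≤ _ := Finset.card_image_le
      _ < (G.neighborFinset v).card := Finset.card_erase_lt_of_mem hy
      _ ≤ 5 := hv
  · push Not at hex
    have hdeg : G.degree v < 5 := by
      by_contra! hge
      obtain ⟨g⟩ : Nonempty (Fin 5 ↪ G.neighborFinset v) :=
        Function.Embedding.nonempty_of_card_le
          (by rwa [Fintype.card_fin, Fintype.card_coe, card_neighborFinset_eq_degree])
      refine hG (isMinorOf_of_injective_hom ⟨fun i => (g i : V), fun {i j} hij => ?_⟩
        (Subtype.val_injective.comp g.injective))
      exact hex _ (g i).2 _ (g j).2 (Subtype.val_injective.ne (g.injective.ne hij))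
    have hs : Fintype.card ({v}ᶜ : Set V) < n :=
      hV ▸ Fintype.card_subtype_lt (x := v) (by simp)
    obtain ⟨c⟩ := ih _ hs rfl (hG.induce {v}ᶜ)
    refine colorable_of_card_image_neighborFinset_lt v
      (fun a => if ha : a = v then 0 else c ⟨a, ha⟩) (fun a b ha hb hab => ?_)
      (Finset.card_image_le.trans_lt hdeg)
    simp only [ha, hb, dite_false]
    exact c.valid (by simpa using hab)

end SimpleGraph

/-- Every `K_5`-minor-free graph has chromatic number at most 5. -/
theorem chromatic_K5_minor_free
    (V : Type) [Fintype V] (G : SimpleGraph V) (hG : G.KMinorFree 5) :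
    G.chromaticNumber ≤ 5 :=
  (SimpleGraph.KMinorFree.colorable_five rfl hG).chromaticNumber_le
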